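/- arXiv:2104.11987 — 3 statements merged into one kernel-verified Lean document; each statement's English description precedes it below -/
import Mathlib

section
/- Let t₀ > 0 and c > 0. Let H be a real Hilbert space, f : H → ℝ convex and differentiable with ∇f Lipschitz continuous on bounded sets, and argmin f nonempty. Let x : [t₀, ∞) → H be a twice differentiable solution of ẍ(t) + (3/t) ẋ(t) + ∇f(x(t)) + (c/t²) x(t) = 0 on [t₀, ∞). Then f(x(t)) − min f = O((ln t)/t²) as t → ∞, i.e. there exist C > 0 and T ≥ max(t₀, 1) such that f(x(t)) − min f ≤ C (ln t)/t² for all t ≥ T. -/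
open Filter Set

/-- The gradient inequality for a convex function on a real Hilbert space. -/
theorem ConvexOn.sub_le_inner_of_hasGradientAt
    {H : Type*} [NormedAddCommGroup H] [InnerProductSpace ℝ H] [CompleteSpace H]
    {f : H → ℝ} {g y : H} (hf : ConvexOn ℝ Set.univ f) (hg : HasGradientAt f g y) (z : H) :
    f y - f z ≤ inner ℝ g (y - z) := by
  have hline : ConvexOn ℝ Set.univ (f ∘ AffineMap.lineMap (k := ℝ) y z) := by
    simpa using hf.comp_affineMap (AffineMap.lineMap (k := ℝ) y z)
  have hderiv : HasDerivAt (f ∘ AffineMap.lineMap (k := ℝ) y z) (inner ℝ g (z - y)) 0 := by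
    have h := hg.hasFDerivAt
    rw [show y = AffineMap.lineMap (k := ℝ) y z (0 : ℝ) by simp] at h
    simpa using h.comp_hasDerivAt (0 : ℝ) AffineMap.hasDerivAt_lineMap
  have h := hline.le_slope_of_hasDerivAt (Set.mem_univ 0) (Set.mem_univ 1) zero_lt_one hderiv
  simp only [slope_def_field, Function.comp_apply, AffineMap.lineMap_apply_one,
    AffineMap.lineMap_apply_zero, sub_zero, div_one] at h
  rw [← neg_sub z y, inner_neg_right]
  linarith

/-- The Lyapunov energy `t² (f(u) - f(z)) + (c/2) ‖u‖² + ½ ‖2 (u - z) + t v‖²` at time `t`,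
position `u` and velocity `v`. -/
noncomputable def trigsEnergy {H : Type*} [NormedAddCommGroup H] [InnerProductSpace ℝ H]
    (f : H → ℝ) (z : H) (c t : ℝ) (u v : H) : ℝ :=
  t ^ 2 * (f u - f z) + c / 2 * ‖u‖ ^ 2 + 1 / 2 * ‖(2 : ℝ) • (u - z) + t • v‖ ^ 2

theorem hasDerivAt_trigsEnergy
    {H : Type*} [NormedAddCommGroup H] [InnerProductSpace ℝ H] [CompleteSpace H]
    {f : H → ℝ} {g z a : H} {c t : ℝ} {x x' : ℝ → H} (ht : 0 < t)
    (hg : HasGradientAt f g (x t)) (hx : HasDerivAt x (x' t) t) (hx' : HasDerivAt x' a t)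
    (hode : a + (3 / t) • x' t + g + (c / t ^ 2) • x t = 0) :
    HasDerivAt (fun s => trigsEnergy f z c s (x s) (x' s))
      (2 * t * (f (x t) - f z - inner ℝ g (x t - z)) - 2 * c / t * inner ℝ (x t - z) (x t)) t := by
  have hf : HasDerivAt (fun s => f (x s)) (inner ℝ g (x' t)) t := by
    simpa [Function.comp_def] using hg.hasFDerivAt.comp_hasDerivAt t hx
  have hw : HasDerivAt (fun s => (2 : ℝ) • (x s - z) + s • x' s)
      (-(t • g) - (c / t) • x t) t := by
    refine (((hx.sub_const z).const_smul (2 : ℝ)).add ((hasDerivAt_id t).smul hx')).congr_deriv ?_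
    have ha : a = -((3 / t) • x' t) - g - (c / t ^ 2) • x t := by
      rw [← sub_eq_zero, ← hode]; abel
    rw [ha, id]
    match_scalars <;> field_simp <;> ring
  have hE := ((((hasDerivAt_id t).pow 2).mul (hf.sub_const (f z))).add
    (hx.norm_sq.const_mul (c / 2))).add (hw.norm_sq.const_mul (1 / 2))
  refine hE.congr_deriv ?_
  simp only [inner_add_left, inner_sub_right, inner_sub_left, inner_neg_right,
    real_inner_smul_left, real_inner_smul_right, id, real_inner_comm g, Pi.pow_apply]
  rw [real_inner_comm (x' t) (x t)]
  field_simp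
  ring

/-- `O((ln t)/t²)` convergence of values in the critical case `α = 3`
(Theorem 3.1 (i)). -/
theorem trigs_critical_value_rate_alpha_eq_three
    {H : Type*} [NormedAddCommGroup H] [InnerProductSpace ℝ H] [CompleteSpace H]
    (f : H → ℝ) (f' : H → H)
    (hconv : ConvexOn ℝ Set.univ f)
    (hgrad : ∀ y, HasGradientAt f (f' y) y)
    (hlip : ∀ s : Set H, Bornology.IsBounded s → ∃ L : NNReal, LipschitzOnWith L f' s)
    (xbar : H) (hmin : ∀ y, f xbar ≤ f y)
    (c t₀ : ℝ) (hc : 0 < c) (ht₀ : 0 < t₀)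
    (x x' x'' : ℝ → H)
    (hx1 : ∀ t, t₀ ≤ t → HasDerivAt x (x' t) t)
    (hx2 : ∀ t, t₀ ≤ t → HasDerivAt x' (x'' t) t)
    (hode : ∀ t, t₀ ≤ t →
      x'' t + (3 / t) • x' t + f' (x t) + (c / t ^ 2) • x t = 0) :
    ∃ C > 0, ∃ T, max t₀ 1 ≤ T ∧ ∀ t, T ≤ t →
      f (x t) - f xbar ≤ C * Real.log t / t ^ 2 := by
  set k := c * ‖xbar‖ ^ 2 with hk
  set G : ℝ → ℝ := fun t => trigsEnergy f xbar c t (x t) (x' t) - k * Real.log t with hG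
  have hk0 : 0 ≤ k := by positivity
  have hderiv : ∀ t, t₀ ≤ t → HasDerivAt G
      (2 * t * (f (x t) - f xbar - inner ℝ (f' (x t)) (x t - xbar))
        - 2 * c / t * inner ℝ (x t - xbar) (x t) - k * t⁻¹) t := fun t ht =>
    (hasDerivAt_trigsEnergy (ht₀.trans_le ht) (hgrad _) (hx1 t ht) (hx2 t ht) (hode t ht)).sub
      ((Real.hasDerivAt_log (ht₀.trans_le ht).ne').const_mul k)
  have hanti : AntitoneOn G (Set.Ici t₀) := by
    refine antitoneOn_of_hasDerivWithinAt_nonpos (convex_Ici t₀)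
      (fun t ht => (hderiv t ht).continuousAt.continuousWithinAt)
      (fun t ht => (hderiv t (interior_subset ht)).hasDerivWithinAt) fun t ht => ?_
    have htpos : 0 < t := ht₀.trans_le (interior_subset ht)
    have hgi := hconv.sub_le_inner_of_hasGradientAt (hgrad (x t)) xbar
    have h1 : 2 * t * (f (x t) - f xbar - inner ℝ (f' (x t)) (x t - xbar)) ≤ 0 :=
      mul_nonpos_of_nonneg_of_nonpos (by positivity) (by linarith)
    have h2 : 0 ≤ 2 * inner ℝ (x t - xbar) (x t) + ‖xbar‖ ^ 2 := by
      have h := norm_sub_sq_real (x t) xbar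
      rw [inner_sub_left, real_inner_self_eq_norm_sq, real_inner_comm]
      nlinarith [sq_nonneg ‖x t‖, sq_nonneg ‖x t - xbar‖]
    have h3 : 2 * c / t * inner ℝ (x t - xbar) (x t) + k * t⁻¹
        = c / t * (2 * inner ℝ (x t - xbar) (x t) + ‖xbar‖ ^ 2) := by
      rw [hk]; field_simp
    have h4 : 0 ≤ c / t * (2 * inner ℝ (x t - xbar) (x t) + ‖xbar‖ ^ 2) := by positivity
    linarith
  refine ⟨|G t₀| + k + 1, by positivity, max t₀ (Real.exp 1),
    max_le_max le_rfl (Real.one_le_exp zero_le_one), fun t ht => ?_⟩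
  have ht0 : t₀ ≤ t := (le_max_left _ _).trans ht
  have htpos : 0 < t := ht₀.trans_le ht0
  have hlog : 1 ≤ Real.log t :=
    (Real.le_log_iff_exp_le htpos).2 ((le_max_right _ _).trans ht)
  have hGt : G t ≤ G t₀ := hanti Set.self_mem_Ici ht0 ht0
  have hE : t ^ 2 * (f (x t) - f xbar) ≤ trigsEnergy f xbar c t (x t) (x' t) := by
    rw [trigsEnergy, add_assoc]
    exact le_add_of_nonneg_right (by positivity)
  rw [le_div_iff₀ (by positivity)]
  simp only [hG] at hGt ⊢
  nlinarith [le_abs_self (G t₀), abs_nonneg (G t₀)]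
end

section
/- Let t₀ > 0, α > 3, and c > 0. Let H be a real Hilbert space, f : H → ℝ convex and differentiable with ∇f Lipschitz continuous on bounded sets, argmin f nonempty, and let x* be the element of minimum norm of argmin f. Let x : [t₀, ∞) → H be a twice differentiable solution of ẍ(t) + (α/t) ẋ(t) + ∇f(x(t)) + (c/t²) x(t) = 0 on [t₀, ∞). Then liminf_{t → ∞} ‖x(t) − x*‖ = 0. -/
open Filter Set

open Topology

section MinimumNorm

variable {H : Type*} [NormedAddCommGroup H] [InnerProductSpace ℝ H]

/-- A convex function lies above its tangent hyperplanes. -/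
theorem ConvexOn.inner_gradient_sub_le [CompleteSpace H] {f : H → ℝ} {g y : H}
    (hf : ConvexOn ℝ Set.univ f) (hg : HasGradientAt f g y) (w : H) :
    f y - f w ≤ inner ℝ g (y - w) := by
  have hline : HasDerivAt (f ∘ AffineMap.lineMap y w) (inner ℝ g (w - y)) (0 : ℝ) := by
    have h0 : HasFDerivAt f (InnerProductSpace.toDual ℝ H g)
        (AffineMap.lineMap y w (0 : ℝ)) := by
      simpa using hg.hasFDerivAt
    simpa using h0.comp_hasDerivAt (0 : ℝ) AffineMap.hasDerivAt_lineMap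
  have hslope := (hf.comp_affineMap (AffineMap.lineMap y w : ℝ →ᵃ[ℝ] H)).le_slope_of_hasDerivAt
    (Set.mem_univ 0) (Set.mem_univ 1) one_pos hline
  simp only [slope_def_field, Function.comp_apply, AffineMap.lineMap_apply_one,
    AffineMap.lineMap_apply_zero, sub_zero, div_one] at hslope
  rw [← neg_sub w y, inner_neg_right]
  linarith

/-- A nonempty closed convex set has an element of minimum norm. -/
theorem IsClosed.exists_norm_le_of_convex [CompleteSpace H] {K : Set H} (hK : IsClosed K)
    (hconv : Convex ℝ K) (hne : K.Nonempty) : ∃ p ∈ K, ∀ u ∈ K, ‖p‖ ≤ ‖u‖ := by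
  obtain ⟨p, hp, hmin⟩ := exists_norm_eq_iInf_of_complete_convex hne hK.isComplete hconv 0
  refine ⟨p, hp, fun u hu => ?_⟩
  have hbdd : BddBelow (Set.range fun w : K => ‖(0 : H) - w‖) :=
    ⟨0, Set.forall_mem_range.2 fun _ => norm_nonneg _⟩
  simpa using hmin.le.trans (ciInf_le hbdd ⟨u, hu⟩)

/-- In a convex set, elements whose norm is nearly minimal are close to the minimal one. -/
theorem Convex.norm_sub_sq_le_of_norm_le {K : Set H} (hK : Convex ℝ K) {p q : H} (hp : p ∈ K)
    (hq : q ∈ K) (hmin : ∀ u ∈ K, ‖p‖ ≤ ‖u‖) : ‖p - q‖ ^ 2 ≤ 2 * (‖q‖ ^ 2 - ‖p‖ ^ 2) := by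
  have hmid := hmin _ (hK hp hq (by norm_num : (0 : ℝ) ≤ 1 / 2) (by norm_num : (0 : ℝ) ≤ 1 / 2)
    (by norm_num))
  rw [← smul_add, norm_smul] at hmid
  norm_num at hmid
  have hpar := parallelogram_law_with_norm ℝ p q
  nlinarith [norm_nonneg p, norm_nonneg (p + q)]

/-- The norm of an approximate minimizer of a continuous convex function is asymptotically at
least that of the minimum norm minimizer. -/
theorem ConvexOn.exists_sublevel_norm_sq_ge [CompleteSpace H] {f : H → ℝ}
    (hf : ConvexOn ℝ Set.univ f) (hcont : Continuous f) {z : H} (hz : ∀ y, f z ≤ f y)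
    (hznorm : ∀ y, (∀ w, f y ≤ f w) → ‖z‖ ≤ ‖y‖) {η : ℝ} (hη : 0 < η) :
    ∃ δ > 0, ∀ u, f u ≤ f z + δ → ‖z‖ ^ 2 - η ≤ ‖u‖ ^ 2 := by
  let K : ℕ → Set H := fun n => {u | f u ≤ f z + 1 / ((n : ℝ) + 1)}
  have hpos : ∀ n : ℕ, (0 : ℝ) < 1 / ((n : ℝ) + 1) := fun n => by positivity
  have hKclosed : ∀ n, IsClosed (K n) := fun n => isClosed_le hcont continuous_const
  have hKconv : ∀ n, Convex ℝ (K n) := fun n => by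
    simpa only [Set.mem_univ, true_and] using hf.convex_le (f z + 1 / ((n : ℝ) + 1))
  have hzK : ∀ n, z ∈ K n := fun n => by
    change f z ≤ _
    linarith [hpos n]
  have hKanti : ∀ n m, n ≤ m → K m ⊆ K n := fun n m hnm u (hu : f u ≤ _) => by
    change f u ≤ _
    linarith [Nat.one_div_le_one_div (α := ℝ) hnm]
  choose p hpK hpmin using fun n => (hKclosed n).exists_norm_le_of_convex (hKconv n) ⟨z, hzK n⟩
  have hmono : Monotone fun n => ‖p n‖ ^ 2 := fun n m hnm => by
    have := hpmin n _ (hKanti n m hnm (hpK m))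
    dsimp only
    gcongr
  have hbdd : BddAbove (Set.range fun n => ‖p n‖ ^ 2) := by
    refine ⟨‖z‖ ^ 2, Set.forall_mem_range.2 fun n => ?_⟩
    have := hpmin n _ (hzK n)
    gcongr
  have hlim := tendsto_atTop_ciSup hmono hbdd
  set L := ⨆ n, ‖p n‖ ^ 2
  have hcauchy : CauchySeq p := by
    refine cauchySeq_of_le_tendsto_0' (fun n => √(2 * (L - ‖p n‖ ^ 2))) (fun n m hnm => ?_) ?_
    · rw [dist_eq_norm]
      refine Real.le_sqrt_of_sq_le ?_
      have h1 := (hKconv n).norm_sub_sq_le_of_norm_le (hpK n) (hKanti n m hnm (hpK m)) (hpmin n)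
      have h2 : ‖p m‖ ^ 2 ≤ L := le_ciSup hbdd m
      linarith
    · have h := ((hlim.const_sub L).const_mul 2).sqrt
      simpa using h
  obtain ⟨q, hq⟩ := cauchySeq_tendsto_of_complete hcauchy
  have hqmin : ∀ w, f q ≤ f w := fun w => by
    refine le_trans ?_ (hz w)
    have h1 := (hcont.tendsto q).comp hq
    have h2 := (tendsto_one_div_add_atTop_nhds_zero_nat (𝕜 := ℝ)).const_add (f z)
    rw [add_zero] at h2
    exact le_of_tendsto_of_tendsto' h1 h2 fun n => hpK n
  have hzq := hznorm q hqmin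
  have hnorm : Tendsto (fun n => ‖p n‖ ^ 2) atTop (𝓝 (‖q‖ ^ 2)) := hq.norm.pow 2
  have hlt : ‖z‖ ^ 2 - η < ‖q‖ ^ 2 := by
    have : ‖z‖ ^ 2 ≤ ‖q‖ ^ 2 := by gcongr
    linarith
  obtain ⟨n, hn⟩ := (hnorm.eventually (lt_mem_nhds hlt)).exists
  refine ⟨_, hpos n, fun u hu => hn.le.trans ?_⟩
  have := hpmin n u hu
  gcongr

/-- Tikhonov regularization with a large weight on the objective does not drop
asymptotically below its value at the minimum norm minimizer. -/
theorem ConvexOn.eventually_tikhonov_ge [CompleteSpace H] {f : H → ℝ}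
    (hf : ConvexOn ℝ Set.univ f) (hcont : Continuous f) {z : H} (hz : ∀ y, f z ≤ f y)
    (hznorm : ∀ y, (∀ w, f y ≤ f w) → ‖z‖ ≤ ‖y‖) {η : ℝ} (hη : 0 < η) :
    ∀ᶠ T : ℝ in atTop, ∀ u, -η ≤ T * (f u - f z) + (‖u‖ ^ 2 - ‖z‖ ^ 2) := by
  obtain ⟨δ, hδ, hsub⟩ := hf.exists_sublevel_norm_sq_ge hcont hz hznorm hη
  filter_upwards [eventually_ge_atTop (0 : ℝ), eventually_ge_atTop (‖z‖ ^ 2 / δ)] with T hT0 hT u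
  rcases le_or_gt (f u) (f z + δ) with h | h
  · have := mul_nonneg hT0 (sub_nonneg.2 (hz u))
    linarith [hsub u h]
  · have h1 : ‖z‖ ^ 2 ≤ T * δ := (div_le_iff₀ hδ).1 hT
    have h2 : T * δ ≤ T * (f u - f z) := by gcongr; linarith
    nlinarith [sq_nonneg ‖u‖]

end MinimumNorm

/-- A function with derivative at most `-κ / t` for large `t`, where `κ > 0`, is not bounded
below. -/
theorem not_bddBelow_of_hasDerivAt_le_neg_div {V V' : ℝ → ℝ} {T κ m : ℝ} (hT : 0 < T) (hκ : 0 < κ)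
    (hV : ∀ t, T ≤ t → HasDerivAt V (V' t) t) (hV' : ∀ t, T ≤ t → V' t ≤ -κ / t) :
    ¬ ∀ t, T ≤ t → m ≤ V t := by
  intro hm
  have hder : ∀ t, T ≤ t → HasDerivAt (fun t => V t + κ * Real.log t) (V' t + κ * t⁻¹) t :=
    fun t ht => (hV t ht).add ((Real.hasDerivAt_log (hT.trans_le ht).ne').const_mul κ)
  have hanti : AntitoneOn (fun t => V t + κ * Real.log t) (Set.Ici T) := by
    refine antitoneOn_of_hasDerivWithinAt_nonpos (f' := fun t => V' t + κ * t⁻¹) (convex_Ici T)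
      (fun t ht => (hder t ht).continuousAt.continuousWithinAt)
      (fun t ht => (hder t (interior_subset ht)).hasDerivWithinAt) fun t ht => ?_
    have := hV' t (interior_subset ht)
    rw [neg_div, div_eq_mul_inv] at this
    linarith
  obtain ⟨t, htT, ht⟩ := ((eventually_ge_atTop T).and
    ((Real.tendsto_log_atTop.const_mul_atTop hκ).eventually_gt_atTop
      (V T + κ * Real.log T - m))).exists
  have h1 := hanti (Set.mem_Ici.2 le_rfl) (Set.mem_Ici.2 htT) htT
  dsimp only at h1
  linarith [hm t htT]

/-- A nonnegative real function that is frequently below every positive number has lower limit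
zero. -/
theorem liminf_eq_zero_of_frequently_lt {ι : Type*} {l : Filter ι} {u : ι → ℝ}
    (h0 : ∀ i, 0 ≤ u i) (h : ∀ ε > 0, ∃ᶠ i in l, u i < ε) : liminf u l = 0 := by
  rw [liminf_eq]
  refine IsGreatest.csSup_eq ⟨Eventually.of_forall h0, fun a ha => ?_⟩
  by_contra! hlt
  obtain ⟨i, hi, hi'⟩ := ((h a hlt).and_eventually ha).exists
  exact absurd hi' (not_le.2 hi)

/-- The derivative of the energy
`½‖(α - 1)(x - z) + t x'‖² + t² (f x - m) + (c / 2)‖x‖²` along the dynamic. -/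
theorem hasDerivAt_tikhonov_energy {H : Type*} [NormedAddCommGroup H] [InnerProductSpace ℝ H]
    [CompleteSpace H] {f : H → ℝ} {g z a : H} {x x' : ℝ → H} {α c m t : ℝ} (ht : t ≠ 0)
    (hg : HasGradientAt f g (x t)) (hx : HasDerivAt x (x' t) t) (hx' : HasDerivAt x' a t)
    (hode : a + (α / t) • x' t + g + (c / t ^ 2) • x t = 0) :
    HasDerivAt (fun t => 1 / 2 * ‖(α - 1) • (x t - z) + t • x' t‖ ^ 2 + t ^ 2 * (f (x t) - m)
        + c / 2 * ‖x t‖ ^ 2)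
      (2 * t * (f (x t) - m) - (α - 1) * t * inner ℝ g (x t - z)
        - (α - 1) * c / t * inner ℝ (x t) (x t - z)) t := by
  have hv : HasDerivAt (fun t => (α - 1) • (x t - z) + t • x' t)
      ((α - 1) • x' t + (t • a + (1 : ℝ) • x' t)) t :=
    ((hx.sub_const z).const_smul (α - 1)).add ((hasDerivAt_id t).smul hx')
  have hfx : HasDerivAt (fun t => f (x t)) (inner ℝ g (x' t)) t := by
    simpa [Function.comp_def] using hg.hasFDerivAt.comp_hasDerivAt t hx
  have ha : (α - 1) • x' t + (t • a + (1 : ℝ) • x' t) = -(t • g) - (c / t) • x t := by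
    have h1 : a = -((α / t) • x' t + g + (c / t ^ 2) • x t) := by
      rw [eq_neg_iff_add_eq_zero, ← hode]
      abel
    rw [h1]
    match_scalars <;> field_simp <;> ring
  rw [ha] at hv
  refine HasDerivAt.congr_deriv (((hv.norm_sq.const_mul (1 / 2)).add
    (((hasDerivAt_id t).pow 2).mul (hfx.sub_const m))).add (hx.norm_sq.const_mul (c / 2))) ?_
  norm_num only [inner_add_left, inner_add_right, inner_sub_right, inner_neg_right, inner_smul_left,
    inner_smul_right, inner_sub_left, id, RCLike.conj_to_real, Pi.pow_apply, real_inner_comm g,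
    real_inner_comm (x t) z, real_inner_comm (x t) (x' t)]
  field_simp
  ring

/-- `liminf ‖x(t) − x*‖ = 0` towards the minimum norm solution for the critical
dynamic with `α > 3` (Theorem 3.2, first claim). -/
theorem trigs_critical_liminf_strong_convergence
    {H : Type*} [NormedAddCommGroup H] [InnerProductSpace ℝ H] [CompleteSpace H]
    (f : H → ℝ) (f' : H → H)
    (hconv : ConvexOn ℝ Set.univ f)
    (hgrad : ∀ y, HasGradientAt f (f' y) y)
    (hlip : ∀ s : Set H, Bornology.IsBounded s → ∃ L : NNReal, LipschitzOnWith L f' s)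
    (xstar : H)
    (hxstar_min : ∀ y, f xstar ≤ f y)
    (hxstar_norm : ∀ y, (∀ z, f y ≤ f z) → ‖xstar‖ ≤ ‖y‖)
    (α c t₀ : ℝ) (hα : 3 < α) (hc : 0 < c) (ht₀ : 0 < t₀)
    (x x' x'' : ℝ → H)
    (hx1 : ∀ t, t₀ ≤ t → HasDerivAt x (x' t) t)
    (hx2 : ∀ t, t₀ ≤ t → HasDerivAt x' (x'' t) t)
    (hode : ∀ t, t₀ ≤ t →
      x'' t + (α / t) • x' t + f' (x t) + (c / t ^ 2) • x t = 0) :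
    Filter.liminf (fun t => ‖x t - xstar‖) atTop = 0 := by
  refine liminf_eq_zero_of_frequently_lt (fun t => norm_nonneg _) fun ε hε => ?_
  by_contra hfreq
  rw [not_frequently] at hfreq
  have hcont : Continuous f :=
    continuous_iff_continuousAt.2 fun y => (hgrad y).hasFDerivAt.continuousAt
  have hK : Tendsto (fun t : ℝ => 2 * (α - 3) / ((α - 1) * c) * t ^ 2) atTop atTop :=
    (tendsto_pow_atTop two_ne_zero).const_mul_atTop
      (div_pos (by linarith) (mul_pos (by linarith) hc))
  have htik := hK.eventually (hconv.eventually_tikhonov_ge hcont hxstar_min hxstar_norm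
    (show 0 < ε ^ 2 / 2 by positivity))
  obtain ⟨T, hT⟩ := eventually_atTop.1 ((hfreq.and htik).and (eventually_ge_atTop t₀))
  have hT₀ : ∀ t, T ≤ t → t₀ ≤ t := fun t ht => (hT t ht).2
  have hpos : ∀ t, T ≤ t → 0 < t := fun t ht => ht₀.trans_le (hT₀ t ht)
  refine not_bddBelow_of_hasDerivAt_le_neg_div (m := 0) (hpos T le_rfl)
    (show 0 < (α - 1) * c * ε ^ 2 / 4 by
      have : 0 < α - 1 := by linarith
      positivity)
    (fun t ht => hasDerivAt_tikhonov_energy (z := xstar) (m := f xstar) (hpos t ht).ne'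
      (hgrad (x t)) (hx1 t (hT₀ t ht)) (hx2 t (hT₀ t ht)) (hode t (hT₀ t ht)))
    (fun t ht => ?_) (fun t ht => ?_)
  · obtain ⟨⟨hfar, htk⟩, -⟩ := hT t ht
    have htp := hpos t ht
    have hα1 : 0 < α - 1 := by linarith
    have hgr := hconv.inner_gradient_sub_le (hgrad (x t)) xstar
    have hfar2 : ε ^ 2 ≤ ‖x t - xstar‖ ^ 2 := by
      have := not_lt.1 hfar
      gcongr
    have hin : inner ℝ (x t) (x t - xstar)
        = (‖x t‖ ^ 2 - ‖xstar‖ ^ 2 + ‖x t - xstar‖ ^ 2) / 2 := by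
      rw [norm_sub_sq_real, inner_sub_right, real_inner_self_eq_norm_sq]
      ring
    have hlow : ε ^ 2 / 2 ≤ 2 * (α - 3) / ((α - 1) * c) * t ^ 2 * (f (x t) - f xstar)
        + 2 * inner ℝ (x t) (x t - xstar) := by
      linarith [htk (x t)]
    have hmul := mul_le_mul_of_nonneg_left hlow (show 0 ≤ (α - 1) * c / 2 by positivity)
    have heq : (α - 1) * c / 2 * (2 * (α - 3) / ((α - 1) * c) * t ^ 2 * (f (x t) - f xstar)
        + 2 * inner ℝ (x t) (x t - xstar)) = (α - 3) * t ^ 2 * (f (x t) - f xstar)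
        + (α - 1) * c * inner ℝ (x t) (x t - xstar) := by
      field_simp
    rw [heq] at hmul
    have hgr2 := mul_le_mul_of_nonneg_left hgr (show 0 ≤ (α - 1) * t ^ 2 by positivity)
    rw [le_div_iff₀ htp]
    have hexp : (2 * t * (f (x t) - f xstar) - (α - 1) * t * inner ℝ (f' (x t)) (x t - xstar)
        - (α - 1) * c / t * inner ℝ (x t) (x t - xstar)) * t
        = 2 * t ^ 2 * (f (x t) - f xstar)
          - (α - 1) * t ^ 2 * inner ℝ (f' (x t)) (x t - xstar)
          - (α - 1) * c * inner ℝ (x t) (x t - xstar) := by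
      field_simp
    rw [hexp]
    linarith
  · have := sub_nonneg.2 (hxstar_min (x t))
    positivity
end

section
/- Let t₀ > 0, α > 3, and c > 0. Let H be a real Hilbert space, f : H → ℝ convex and differentiable with ∇f Lipschitz continuous on bounded sets, argmin f nonempty, and let x* be the element of minimum norm of argmin f. Let x : [t₀, ∞) → H be a twice differentiable solution of ẍ(t) + (α/t) ẋ(t) + ∇f(x(t)) + (c/t²) x(t) = 0 on [t₀, ∞). If there exists T ≥ t₀ such that either ‖x(t)‖ < ‖x*‖ for all t ≥ T, or ‖x(t)‖ ≥ ‖x*‖ for all t ≥ T, then x(t) converges strongly to x* as t → ∞, i.e. ‖x(t) − x*‖ → 0. -/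
open Filter Set

open scoped Topology RealInnerProductSpace

section MinimumNorm

variable {H : Type*} [NormedAddCommGroup H] [InnerProductSpace ℝ H]

/-- The gradient inequality for a convex function. -/
lemma ConvexOn.add_inner_le_of_hasGradientAt [CompleteSpace H] {f : H → ℝ} {g y : H}
    (hf : ConvexOn ℝ univ f) (hg : HasGradientAt f g y) (z : H) :
    f y + ⟪g, z - y⟫ ≤ f z := by
  have hline : ConvexOn ℝ univ (f ∘ AffineMap.lineMap (k := ℝ) y z) := by
    simpa using hf.comp_affineMap (AffineMap.lineMap (k := ℝ) y z)
  have hder : HasDerivAt (f ∘ AffineMap.lineMap (k := ℝ) y z) ⟪g, z - y⟫ 0 := by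
    have hl : HasDerivAt (AffineMap.lineMap (k := ℝ) y z) (z - y) (0 : ℝ) :=
      AffineMap.hasDerivAt_lineMap
    have hg' : HasFDerivAt f (InnerProductSpace.toDual ℝ H g) (AffineMap.lineMap y z (0 : ℝ)) := by
      simpa using hg.hasFDerivAt
    simpa using hg'.comp_hasDerivAt (0 : ℝ) hl
  have := hline.le_slope_of_hasDerivAt (mem_univ 0) (mem_univ 1) one_pos hder
  simp only [slope_def_field, Function.comp_apply, AffineMap.lineMap_apply_zero,
    AffineMap.lineMap_apply_one, sub_zero, div_one] at this
  linarith

/-- The element `y` of minimum norm of a closed convex set satisfies the obtuse angle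
inequality. -/
lemma IsClosed.exists_norm_sq_add_norm_sub_sq_le [CompleteSpace H] {K : Set H}
    (hK : IsClosed K) (hconv : Convex ℝ K) (hne : K.Nonempty) :
    ∃ y ∈ K, ∀ w ∈ K, ‖y‖ ^ 2 + ‖w - y‖ ^ 2 ≤ ‖w‖ ^ 2 := by
  obtain ⟨y, hy, hyK⟩ := exists_norm_eq_iInf_of_complete_convex hne hK.isComplete hconv 0
  refine ⟨y, hy, fun w hw => ?_⟩
  have h := (norm_eq_iInf_iff_real_inner_le_zero hconv hy).1 hyK w hw
  have hsq := norm_add_sq_real y (w - y)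
  rw [zero_sub, inner_neg_left] at h
  rw [add_sub_cancel] at hsq
  linarith

/-- A minimizing family of a continuous convex function whose norm does not exceed that of the
minimum norm minimizer converges strongly to this minimizer. -/
lemma ConvexOn.tendsto_of_norm_le_of_tendsto_min [CompleteSpace H] {f : H → ℝ}
    (hf : ConvexOn ℝ univ f) (hcont : Continuous f) {p : H} (hmin : ∀ y, f p ≤ f y)
    (hnorm : ∀ y, (∀ z, f y ≤ f z) → ‖p‖ ≤ ‖y‖) {ι : Type*} {l : Filter ι} {u : ι → H}
    (hu : ∀ᶠ i in l, ‖u i‖ ≤ ‖p‖) (hfu : Tendsto (fun i => f (u i)) l (𝓝 (f p))) :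
    Tendsto u l (𝓝 p) := by
  let K : ℕ → Set H := fun n => {y | f y ≤ f p + 1 / ((n : ℝ) + 1)}
  have hpK (n : ℕ) : p ∈ K n := by
    have : (0 : ℝ) < 1 / ((n : ℝ) + 1) := Nat.one_div_pos_of_nat
    simp only [K, mem_ofPred_eq]
    linarith
  have hproj (n : ℕ) : ∃ y ∈ K n, ∀ w ∈ K n, ‖y‖ ^ 2 + ‖w - y‖ ^ 2 ≤ ‖w‖ ^ 2 :=
    IsClosed.exists_norm_sq_add_norm_sub_sq_le (isClosed_le hcont continuous_const)
      (by simpa [K] using hf.convex_le (f p + 1 / ((n : ℝ) + 1))) ⟨p, hpK n⟩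
  choose y hyK hy using hproj
  have hKanti {m n : ℕ} (hmn : m ≤ n) : K n ⊆ K m := fun w hw =>
    le_trans (mem_ofPred_eq ▸ hw) (add_le_add_right (Nat.one_div_le_one_div hmn) _)
  have hdist {m n : ℕ} (hmn : m ≤ n) : ‖y m‖ ^ 2 + ‖y n - y m‖ ^ 2 ≤ ‖y n‖ ^ 2 :=
    hy m _ (hKanti hmn (hyK n))
  have hmono : Monotone fun n => ‖y n‖ ^ 2 := fun m n hmn => by
    nlinarith [hdist hmn, sq_nonneg ‖y n - y m‖]
  have hbdd : BddAbove (range fun n => ‖y n‖ ^ 2) := by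
    refine ⟨‖p‖ ^ 2, ?_⟩
    rintro _ ⟨n, rfl⟩
    nlinarith [hy n p (hpK n), sq_nonneg ‖p - y n‖]
  have hcauchy : CauchySeq y := by
    have hc := (tendsto_atTop_ciSup hmono hbdd).cauchySeq
    rw [Metric.cauchySeq_iff'] at hc ⊢
    intro ε hε
    obtain ⟨N, hN⟩ := hc (ε ^ 2) (by positivity)
    refine ⟨N, fun n hn => ?_⟩
    have h := hN n hn
    rw [Real.dist_eq, abs_lt] at h
    rw [dist_eq_norm]
    exact lt_of_pow_lt_pow_left₀ 2 hε.le (by linarith [hdist hn])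
  obtain ⟨q, hq⟩ := cauchySeq_tendsto_of_complete hcauchy
  have hfq : f q ≤ f p := by
    have h1 : Tendsto (fun n => f (y n)) atTop (𝓝 (f q)) := (hcont.tendsto q).comp hq
    have h2 : Tendsto (fun n : ℕ => f p + 1 / ((n : ℝ) + 1)) atTop (𝓝 (f p + 0)) :=
      tendsto_one_div_add_atTop_nhds_zero_nat.const_add _
    simpa using le_of_tendsto_of_tendsto' h1 h2 hyK
  have hpq : q = p := by
    have h1 : ‖q‖ ^ 2 + ‖p - q‖ ^ 2 ≤ ‖p‖ ^ 2 :=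
      le_of_tendsto ((hq.norm.pow 2).add ((hq.const_sub p).norm.pow 2))
        (Eventually.of_forall fun n => hy n p (hpK n))
    have h2 : ‖p‖ ≤ ‖q‖ := hnorm q fun z => hfq.trans (hmin z)
    have h3 : ‖p - q‖ ^ 2 ≤ 0 := by nlinarith [norm_nonneg p]
    have h4 : ‖p - q‖ = 0 := pow_eq_zero_iff two_ne_zero |>.1 (le_antisymm h3 (sq_nonneg _))
    exact (sub_eq_zero.1 (norm_eq_zero.1 h4)).symm
  subst hpq
  rw [Metric.tendsto_nhds]
  intro ε hε
  have hsq : Tendsto (fun n => ‖q‖ ^ 2 - ‖y n‖ ^ 2) atTop (𝓝 0) := by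
    have h := (hq.norm.pow 2).const_sub (‖q‖ ^ 2)
    rwa [sub_self] at h
  obtain ⟨n, hn1, hn2⟩ := ((hsq.eventually_lt_const (show (0 : ℝ) < (ε / 2) ^ 2 by positivity)).and
    (Metric.tendsto_nhds.1 hq (ε / 2) (by positivity))).exists
  have hlt : f q < f q + 1 / ((n : ℝ) + 1) := lt_add_of_pos_right _ Nat.one_div_pos_of_nat
  filter_upwards [hu, hfu.eventually_lt_const hlt] with i hi1 hi2
  have h1 : ‖u i - y n‖ < ε / 2 := by
    refine lt_of_pow_lt_pow_left₀ 2 (by positivity) ?_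
    have := hy n (u i) hi2.le
    have : ‖u i‖ ^ 2 ≤ ‖q‖ ^ 2 := by gcongr
    linarith
  calc dist (u i) q ≤ dist (u i) (y n) + dist (y n) q := dist_triangle _ _ _
    _ < ε / 2 + ε / 2 := add_lt_add (by rwa [dist_eq_norm]) hn2
    _ = ε := add_halves ε

end MinimumNorm

section DifferentialInequality

lemma antitoneOn_Ici_of_exists_hasDerivAt_nonpos {E : ℝ → ℝ} {T : ℝ}
    (h : ∀ t, T ≤ t → ∃ d ≤ 0, HasDerivAt E d t) : AntitoneOn E (Ici T) := by
  have hderiv (t : ℝ) (ht : T ≤ t) : DifferentiableAt ℝ E t ∧ deriv E t ≤ 0 := by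
    obtain ⟨d, hd, hE⟩ := h t ht
    exact ⟨hE.differentiableAt, hE.deriv ▸ hd⟩
  refine antitoneOn_of_deriv_nonpos (convex_Ici T)
    (fun t ht => (hderiv t ht).1.continuousAt.continuousWithinAt)
    (fun t ht => (hderiv t (interior_subset ht)).1.differentiableWithinAt)
    (fun t ht => (hderiv t (interior_subset ht)).2)

/-- A nonnegative solution of `E' ≤ -(K / t) E` with `K > 0` tends to zero. -/
lemma tendsto_zero_of_exists_hasDerivAt_le_neg_div_mul {E : ℝ → ℝ} {K T : ℝ} (hK : 0 < K)
    (hT : 0 < T) (hE : ∀ t, T ≤ t → 0 ≤ E t)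
    (h : ∀ t, T ≤ t → ∃ d ≤ -(K / t) * E t, HasDerivAt E d t) :
    Tendsto E atTop (𝓝 0) := by
  have hanti : AntitoneOn (fun t => t ^ K * E t) (Ici T) := by
    refine antitoneOn_Ici_of_exists_hasDerivAt_nonpos fun t ht => ?_
    obtain ⟨d, hd, hEd⟩ := h t ht
    have ht0 : 0 < t := hT.trans_le ht
    refine ⟨_, ?_, (Real.hasDerivAt_rpow_const (p := K) (Or.inl ht0.ne')).mul hEd⟩
    have hpow : 0 ≤ t ^ K := Real.rpow_nonneg ht0.le K
    calc K * t ^ (K - 1) * E t + t ^ K * d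
        ≤ K * t ^ (K - 1) * E t + t ^ K * (-(K / t) * E t) := by gcongr
      _ = 0 := by rw [Real.rpow_sub_one ht0.ne']; ring
  have hlim : Tendsto (fun t : ℝ => T ^ K * E T * t ^ (-K)) atTop (𝓝 0) := by
    simpa using (tendsto_rpow_neg_atTop hK).const_mul (T ^ K * E T)
  refine squeeze_zero' ?_ ?_ hlim
  · filter_upwards [eventually_ge_atTop T] with t ht using hE t ht
  · filter_upwards [eventually_ge_atTop T] with t ht
    have ht0 : 0 < t := hT.trans_le ht
    rw [Real.rpow_neg ht0.le, ← div_eq_mul_inv, le_div_iff₀ (Real.rpow_pos_of_pos ht0 K), mul_comm]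
    exact hanti self_mem_Ici ht ht

end DifferentialInequality

section Energy

variable {H : Type*} [NormedAddCommGroup H] [InnerProductSpace ℝ H]

/-- The Lyapunov function of the trajectory `x` with velocity `x'`, anchored at `p`. -/
noncomputable def tikhonovEnergy (f : H → ℝ) (p : H) (α c μ : ℝ) (x x' : ℝ → H) (t : ℝ) : ℝ :=
  t ^ 2 * (f (x t) - f p) + c / 2 * (‖x t‖ ^ 2 - ‖p‖ ^ 2) +
    1 / 2 * ‖μ • (x t - p) + t • x' t‖ ^ 2 + μ * (α - 1 - μ) / 2 * ‖x t - p‖ ^ 2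

/-- An upper bound for the derivative of `tikhonovEnergy` along the trajectories. -/
noncomputable def tikhonovDissipation (f : H → ℝ) (p : H) (α c μ : ℝ) (x x' : ℝ → H)
    (t : ℝ) : ℝ :=
  (2 - μ) * t * (f (x t) - f p) - μ * c / (2 * t) * (‖x t‖ ^ 2 - ‖p‖ ^ 2) -
    μ * c / (2 * t) * ‖x t - p‖ ^ 2 - (α - 1 - μ) * t * ‖x' t‖ ^ 2

variable {f : H → ℝ} {p : H} {α c μ t : ℝ} {x x' : ℝ → H}

lemma exists_hasDerivAt_tikhonovEnergy_le [CompleteSpace H] {g a : H}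
    (hf : ConvexOn ℝ univ f) (hg : HasGradientAt f g (x t)) (hμ : 0 ≤ μ) (ht : 0 < t)
    (hx : HasDerivAt x (x' t) t) (hx' : HasDerivAt x' a t)
    (hode : a + (α / t) • x' t + g + (c / t ^ 2) • x t = 0) :
    ∃ d ≤ tikhonovDissipation f p α c μ x x' t,
      HasDerivAt (tikhonovEnergy f p α c μ x x') d t := by
  have hfx : HasDerivAt (fun s => f (x s)) ⟪g, x' t⟫ t := by
    have h := hg.hasFDerivAt.comp_hasDerivAt t hx
    rwa [InnerProductSpace.toDual_apply_apply] at h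
  have hv : HasDerivAt (fun s => μ • (x s - p) + s • x' s) (μ • x' t + (t • a + (1 : ℝ) • x' t)) t :=
    ((hx.sub_const p).const_smul μ).add ((hasDerivAt_id t).smul hx')
  have hE := (((((hasDerivAt_id t).pow 2).mul (hfx.sub_const (f p))).add
    ((hx.norm_sq.sub_const (‖p‖ ^ 2)).const_mul (c / 2))).add (hv.norm_sq.const_mul (1 / 2))).add
    ((hx.sub_const p).norm_sq.const_mul (μ * (α - 1 - μ) / 2))
  refine ⟨_, ?_, hE⟩
  have ha : a = -((α / t) • x' t + g + (c / t ^ 2) • x t) := by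
    rw [eq_neg_iff_add_eq_zero, ← hode]; abel
  have hta : t • a = -(α • x' t + t • g + (c / t) • x t) := by
    rw [ha, smul_neg, smul_add, smul_add, smul_smul, smul_smul]
    rw [mul_div_cancel₀ _ ht.ne', show t * (c / t ^ 2) = c / t by field_simp]
  have hconv := hf.add_inner_le_of_hasGradientAt hg p
  have hnorm : ‖p‖ ^ 2 = ‖x t‖ ^ 2 - 2 * ⟪x t, x t - p⟫ + ‖x t - p‖ ^ 2 := by
    rw [← norm_sub_sq_real, sub_sub_cancel]
  have hconv' : ⟪g, p - x t⟫ = -⟪g, x t - p⟫ := by rw [← inner_neg_right, neg_sub]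
  have hmul : μ * t * (f (x t) - f p) ≤ μ * t * ⟪g, x t - p⟫ := by
    have : 0 ≤ μ * t := by positivity
    gcongr
    linarith
  rw [hta, tikhonovDissipation, hnorm]
  simp only [inner_add_left, inner_add_right, inner_neg_right, inner_smul_left, inner_smul_right,
    real_inner_self_eq_norm_sq, id, one_smul, conj_trivial, Pi.pow_apply]
  obtain ⟨k, rfl⟩ : ∃ k, c = k * t := ⟨c / t, by field_simp⟩
  rw [mul_div_cancel_right₀ k ht.ne', show μ * (k * t) / (2 * t) = μ * k / 2 by field_simp]
  rw [real_inner_comm g (x' t), real_inner_comm g (x t - p), real_inner_comm (x t) (x' t),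
    real_inner_comm (x t) (x t - p)]
  linear_combination hmul

lemma tikhonovEnergy_le :
    tikhonovEnergy f p α c μ x x' t ≤ t ^ 2 * (f (x t) - f p) + c / 2 * (‖x t‖ ^ 2 - ‖p‖ ^ 2) +
      t ^ 2 * ‖x' t‖ ^ 2 + (μ ^ 2 + μ * (α - 1 - μ) / 2) * ‖x t - p‖ ^ 2 := by
  have h := parallelogram_law_with_norm ℝ (μ • (x t - p)) (t • x' t)
  rw [norm_smul μ, norm_smul t, mul_pow, mul_pow, Real.norm_eq_abs, Real.norm_eq_abs, sq_abs,
    sq_abs] at h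
  rw [tikhonovEnergy]
  linarith [sq_nonneg ‖μ • (x t - p) - t • x' t‖]

lemma tikhonovDissipation_le_of_norm_le {K : ℝ} (hp : ∀ y, f p ≤ f y) (hc : 0 ≤ c) (ht : 0 < t)
    (hK : 0 ≤ K) (hKμ : K ≤ μ - 2) (hKα : K ≤ α - 1 - μ)
    (hKc : K * (μ ^ 2 + μ * (α - 1 - μ) / 2) ≤ μ * c / 2) (hx : ‖p‖ ≤ ‖x t‖) :
    tikhonovDissipation f p α c μ x x' t ≤ -(K / t) * tikhonovEnergy f p α c μ x x' t := by
  have hE := mul_le_mul_of_nonneg_left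
    (tikhonovEnergy_le (f := f) (p := p) (α := α) (c := c) (μ := μ) (t := t) (x := x) (x' := x')) hK
  have hF : 0 ≤ t ^ 2 * (f (x t) - f p) := mul_nonneg (sq_nonneg t) (sub_nonneg.2 (hp _))
  have hN : 0 ≤ c / 2 * (‖x t‖ ^ 2 - ‖p‖ ^ 2) :=
    mul_nonneg (by positivity) (sub_nonneg.2 (by gcongr))
  have hV : 0 ≤ t ^ 2 * ‖x' t‖ ^ 2 := by positivity
  have h1 := mul_le_mul_of_nonneg_right hKμ hF
  have h2 := mul_le_mul_of_nonneg_right (show K ≤ μ by linarith) hN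
  have h3 := mul_le_mul_of_nonneg_right hKα hV
  have h4 := mul_le_mul_of_nonneg_right hKc (sq_nonneg ‖x t - p‖)
  have hD : tikhonovDissipation f p α c μ x x' t * t =
      -((μ - 2) * (t ^ 2 * (f (x t) - f p)) + μ * (c / 2 * (‖x t‖ ^ 2 - ‖p‖ ^ 2)) +
        (α - 1 - μ) * (t ^ 2 * ‖x' t‖ ^ 2) + μ * c / 2 * ‖x t - p‖ ^ 2) := by
    rw [tikhonovDissipation]
    field_simp
    ring
  rw [neg_mul, div_mul_eq_mul_div, ← neg_div, le_div_iff₀ ht, hD]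
  linarith

lemma tikhonovDissipation_le (hp : ∀ y, f p ≤ f y) (hc : 0 ≤ c) (ht : 0 < t) (hμ : 2 ≤ μ)
    (hμα : μ ≤ α - 1) :
    tikhonovDissipation f p α c μ x x' t ≤ μ * c / (2 * t) * ‖p‖ ^ 2 := by
  have hF : 0 ≤ (μ - 2) * t * (f (x t) - f p) :=
    mul_nonneg (mul_nonneg (by linarith) ht.le) (sub_nonneg.2 (hp _))
  have hV : 0 ≤ (α - 1 - μ) * t * ‖x' t‖ ^ 2 :=
    mul_nonneg (mul_nonneg (by linarith) ht.le) (sq_nonneg _)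
  have hN : 0 ≤ μ * c / (2 * t) * ‖x t‖ ^ 2 := by positivity
  have hd : 0 ≤ μ * c / (2 * t) * ‖x t - p‖ ^ 2 := by positivity
  rw [tikhonovDissipation]
  linarith

lemma le_tikhonovEnergy :
    t ^ 2 * (f (x t) - f p) + c / 2 * (‖x t‖ ^ 2 - ‖p‖ ^ 2) +
      μ * (α - 1 - μ) / 2 * ‖x t - p‖ ^ 2 ≤ tikhonovEnergy f p α c μ x x' t := by
  rw [tikhonovEnergy]
  linarith [sq_nonneg ‖μ • (x t - p) + t • x' t‖]

/-- If the derivative of the energy is bounded by the dissipation, the values of `f` along the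
trajectory converge to the minimum. -/
lemma tendsto_of_exists_hasDerivAt_tikhonovEnergy_le {T : ℝ} (hp : ∀ y, f p ≤ f y) (hc : 0 ≤ c)
    (hT : 0 < T) (hμ : 2 ≤ μ) (hμα : μ ≤ α - 1)
    (h : ∀ t, T ≤ t → ∃ d ≤ tikhonovDissipation f p α c μ x x' t,
      HasDerivAt (tikhonovEnergy f p α c μ x x') d t) :
    Tendsto (fun t => f (x t)) atTop (𝓝 (f p)) := by
  set E := tikhonovEnergy f p α c μ x x'
  set M := μ * c / (2 * T) * ‖p‖ ^ 2
  have hanti : AntitoneOn (fun t => E t - M * t) (Ici T) := by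
    refine antitoneOn_Ici_of_exists_hasDerivAt_nonpos fun t ht => ?_
    obtain ⟨d, hd, hEd⟩ := h t ht
    refine ⟨_, ?_, hEd.sub ((hasDerivAt_id t).const_mul M)⟩
    have h1 := tikhonovDissipation_le (x := x) (x' := x') hp hc (hT.trans_le ht) hμ hμα
    have h2 : μ * c / (2 * t) * ‖p‖ ^ 2 ≤ μ * c / (2 * T) * ‖p‖ ^ 2 := by
      have : 0 ≤ μ := by linarith
      gcongr
    linarith
  have hlim : Tendsto (fun t : ℝ => (E T - M * T + c / 2 * ‖p‖ ^ 2) * (t⁻¹ * t⁻¹) + M * t⁻¹) atTop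
      (𝓝 0) := by
    simpa using ((tendsto_inv_atTop_zero.mul tendsto_inv_atTop_zero).const_mul _).add
      (tendsto_inv_atTop_zero.const_mul M)
  refine tendsto_sub_nhds_zero_iff.1 (squeeze_zero' ?_ ?_ hlim)
  · exact Eventually.of_forall fun t => sub_nonneg.2 (hp _)
  · filter_upwards [eventually_ge_atTop T] with t ht
    have ht0 : 0 < t := hT.trans_le ht
    have h1 : E t - M * t ≤ E T - M * T := hanti self_mem_Ici ht ht
    have h2 : _ ≤ E t := le_tikhonovEnergy
    have h3 : 0 ≤ c / 2 * ‖x t‖ ^ 2 := by positivity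
    have h4 : 0 ≤ μ * (α - 1 - μ) / 2 * ‖x t - p‖ ^ 2 := by
      have : 0 ≤ μ * (α - 1 - μ) := mul_nonneg (by linarith) (by linarith)
      positivity
    have h5 : f (x t) - f p ≤ (E T - M * T + c / 2 * ‖p‖ ^ 2 + M * t) / t ^ 2 := by
      rw [le_div_iff₀ (by positivity)]
      linarith
    refine h5.trans_eq ?_
    field_simp

end Energy

/-- Strong convergence to the minimum norm solution when the trajectory eventually
stays in the open ball `B(0,‖x*‖)` or in its complement (Theorem 3.2, second claim). -/
theorem trigs_critical_strong_convergence_ball_condition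
    {H : Type*} [NormedAddCommGroup H] [InnerProductSpace ℝ H] [CompleteSpace H]
    (f : H → ℝ) (f' : H → H)
    (hconv : ConvexOn ℝ Set.univ f)
    (hgrad : ∀ y, HasGradientAt f (f' y) y)
    (hlip : ∀ s : Set H, Bornology.IsBounded s → ∃ L : NNReal, LipschitzOnWith L f' s)
    (xstar : H)
    (hxstar_min : ∀ y, f xstar ≤ f y)
    (hxstar_norm : ∀ y, (∀ z, f y ≤ f z) → ‖xstar‖ ≤ ‖y‖)
    (α c t₀ : ℝ) (hα : 3 < α) (hc : 0 < c) (ht₀ : 0 < t₀)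
    (x x' x'' : ℝ → H)
    (hx1 : ∀ t, t₀ ≤ t → HasDerivAt x (x' t) t)
    (hx2 : ∀ t, t₀ ≤ t → HasDerivAt x' (x'' t) t)
    (hode : ∀ t, t₀ ≤ t →
      x'' t + (α / t) • x' t + f' (x t) + (c / t ^ 2) • x t = 0)
    (hball : ∃ T, t₀ ≤ T ∧
      ((∀ t, T ≤ t → ‖x t‖ < ‖xstar‖) ∨ (∀ t, T ≤ t → ‖xstar‖ ≤ ‖x t‖))) :
    Tendsto x atTop (nhds xstar) := by
  obtain ⟨T, hT, hT'⟩ := hball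
  have hT0 : 0 < T := ht₀.trans_le hT
  obtain ⟨μ, hμ, hμα⟩ : ∃ μ, 2 < μ ∧ μ < α - 1 := exists_between (by linarith)
  have hderiv (t : ℝ) (ht : T ≤ t) :
      ∃ d ≤ tikhonovDissipation f xstar α c μ x x' t,
        HasDerivAt (tikhonovEnergy f xstar α c μ x x') d t :=
    exists_hasDerivAt_tikhonovEnergy_le hconv (hgrad _) (by linarith) (hT0.trans_le ht)
      (hx1 t (hT.trans ht)) (hx2 t (hT.trans ht)) (hode t (hT.trans ht))
  rcases hT' with hin | hout
  · have hcont : Continuous f := continuous_iff_continuousAt.2 fun y => (hgrad y).continuousAt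
    refine hconv.tendsto_of_norm_le_of_tendsto_min hcont hxstar_min hxstar_norm ?_
      (tendsto_of_exists_hasDerivAt_tikhonovEnergy_le hxstar_min hc.le hT0 hμ.le hμα.le hderiv)
    filter_upwards [eventually_ge_atTop T] with t ht using (hin t ht).le
  · have hβ : 0 < μ * (α - 1 - μ) / 2 :=
      div_pos (mul_pos (by linarith) (by linarith)) two_pos
    have hA : 0 < μ ^ 2 + μ * (α - 1 - μ) / 2 := by positivity
    obtain ⟨K, hK, hKlt⟩ : ∃ K, 0 < K ∧
        K < min (min (μ - 2) (α - 1 - μ)) (μ * c / 2 / (μ ^ 2 + μ * (α - 1 - μ) / 2)) := by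
      refine exists_between (lt_min (lt_min (by linarith) (by linarith)) (div_pos ?_ hA))
      have : 0 < μ := by linarith
      positivity
    rw [lt_min_iff, lt_min_iff, lt_div_iff₀ hA] at hKlt
    obtain ⟨⟨hKμ, hKα⟩, hKc⟩ := hKlt
    have hlower (t : ℝ) (ht : T ≤ t) :
        μ * (α - 1 - μ) / 2 * ‖x t - xstar‖ ^ 2 ≤ tikhonovEnergy f xstar α c μ x x' t := by
      have hF : 0 ≤ t ^ 2 * (f (x t) - f xstar) :=
        mul_nonneg (sq_nonneg t) (sub_nonneg.2 (hxstar_min _))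
      have hN : 0 ≤ c / 2 * (‖x t‖ ^ 2 - ‖xstar‖ ^ 2) :=
        mul_nonneg (by positivity) (sub_nonneg.2 (by have := hout t ht; gcongr))
      have h := le_tikhonovEnergy (f := f) (p := xstar) (α := α) (c := c) (μ := μ) (t := t)
        (x := x) (x' := x')
      linarith
    have hE : Tendsto (tikhonovEnergy f xstar α c μ x x') atTop (nhds 0) := by
      refine tendsto_zero_of_exists_hasDerivAt_le_neg_div_mul hK hT0
        (fun t ht => le_trans (by positivity) (hlower t ht)) fun t ht => ?_
      obtain ⟨d, hd, hEd⟩ := hderiv t ht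
      exact ⟨d, hd.trans (tikhonovDissipation_le_of_norm_le hxstar_min hc.le (hT0.trans_le ht)
        hK.le hKμ.le hKα.le hKc.le (hout t ht)), hEd⟩
    have hsq : Tendsto (fun t => ‖x t - xstar‖ ^ 2) atTop (nhds 0) := by
      refine squeeze_zero' (Eventually.of_forall fun t => sq_nonneg _) ?_
        (by simpa using hE.div_const (μ * (α - 1 - μ) / 2))
      filter_upwards [eventually_ge_atTop T] with t ht
      rw [le_div_iff₀ hβ, mul_comm]
      exact hlower t ht
    rw [tendsto_iff_norm_sub_tendsto_zero]
    simpa using hsq.sqrt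
end
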